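/- arXiv:1102.2702 — 2 statements merged into one kernel-verified Lean document; each statement's English description precedes it below -/
import Mathlib

section
/- Let C be a subgroup of S_n with minimal degree d (every non-identity element moves at least d points), and suppose there exist t > 0 and 0 < p < 1/2 with e^{−2t²/n} + |C| · e^{−d p² / (2(1−p))} < 1. Then there exists a labeling l ∈ S_n such that the minimal ℓ∞-distance satisfies d(l C l^{-1}) ≥ n + 1 − ⌊2pn + t⌋. -/
/-- The ℓ∞-weight of a permutation of `Fin n`: `max_i |f i - i|`. -/
def wt {n : ℕ} (f : Equiv.Perm (Fin n)) : ℕ :=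
  Finset.univ.sup fun i : Fin n => ((f i : ℤ) - (i : ℤ)).natAbs

/-- Weights of the three colours. -/
noncomputable def cw (p : ℝ) : Fin 3 → ℝ := ![p, 1 - 2 * p, p]

/-- Expectation over independent colourings. -/
noncomputable def Ex (p : ℝ) {n : ℕ} (F : (Fin n → Fin 3) → ℝ) : ℝ :=
  ∑ χ : Fin n → Fin 3, (∏ i, cw p (χ i)) * F χ

/-- Compatibility of two colours. -/
noncomputable def Ac (a b : Fin 3) : ℝ :=
  if (a = 0 ∧ b = 2) ∨ (a = 2 ∧ b = 0) then 0 else 1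

/-- Indicator of being coloured. -/
noncomputable def col (a : Fin 3) : ℝ := if a = 1 then 0 else 1

lemma cw_sum (p : ℝ) : ∑ c, cw p c = 1 := by
  simp [cw, Fin.sum_univ_three]; ring

lemma cw_nonneg {p : ℝ} (h0 : 0 < p) (h2 : p < 1 / 2) (c : Fin 3) : 0 ≤ cw p c := by
  fin_cases c <;> simp [cw] <;> linarith

lemma Ac_nonneg (a b : Fin 3) : 0 ≤ Ac a b := by unfold Ac; split_ifs <;> norm_num
lemma Ac_le_one (a b : Fin 3) : Ac a b ≤ 1 := by unfold Ac; split_ifs <;> norm_num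
lemma col_nonneg (a : Fin 3) : 0 ≤ col a := by unfold col; split_ifs <;> norm_num
lemma col_le_one (a : Fin 3) : col a ≤ 1 := by unfold col; split_ifs <;> norm_num

lemma cw_Ac (p : ℝ) (a : Fin 3) : ∑ c, cw p c * Ac a c = 1 - p * col a := by
  fin_cases a <;> simp [cw, Ac, col, Fin.sum_univ_three] <;> ring

lemma cw_Ac_col (p : ℝ) (a : Fin 3) : ∑ c, cw p c * (Ac a c * col c) = 2 * p - p * col a := by
  fin_cases a <;> simp [cw, Ac, col, Fin.sum_univ_three] <;> ring

lemma cw_col (p : ℝ) : ∑ c, cw p c * col c = 2 * p := by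
  simp [cw, col, Fin.sum_univ_three]; ring

lemma Ex_mono {p : ℝ} (h0 : 0 < p) (h2 : p < 1 / 2) {n : ℕ} {F G : (Fin n → Fin 3) → ℝ}
    (h : ∀ χ, F χ ≤ G χ) : Ex p F ≤ Ex p G :=
  Finset.sum_le_sum fun χ _ => mul_le_mul_of_nonneg_left (h χ)
    (Finset.prod_nonneg fun i _ => cw_nonneg h0 h2 _)

lemma Ex_prod (p : ℝ) {n : ℕ} (f : Fin 3 → ℝ) :
    Ex p (fun χ : Fin n → Fin 3 => ∏ i, f (χ i)) = (∑ c, cw p c * f c) ^ n := by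
  unfold Ex
  simp_rw [← Finset.prod_mul_distrib]
  rw [← Fintype.piFinset_univ,
    ← Finset.prod_univ_sum (fun _ : Fin n => (Finset.univ : Finset (Fin 3)))
      (fun _ c => cw p c * f c)]
  simp

lemma Ex_one (p : ℝ) {n : ℕ} : Ex p (fun _ : Fin n → Fin 3 => (1 : ℝ)) = 1 := by
  have := Ex_prod p (n := n) (fun _ => 1)
  simpa [cw_sum] using this

lemma Ex_add (p : ℝ) {n : ℕ} (F G : (Fin n → Fin 3) → ℝ) :
    Ex p (fun χ => F χ + G χ) = Ex p F + Ex p G := by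
  simp [Ex, mul_add, Finset.sum_add_distrib]

lemma Ex_sub (p : ℝ) {n : ℕ} (F G : (Fin n → Fin 3) → ℝ) :
    Ex p (fun χ => F χ - G χ) = Ex p F - Ex p G := by
  simp [Ex, mul_sub, Finset.sum_sub_distrib]

lemma Ex_smul (p : ℝ) {n : ℕ} (a : ℝ) (F : (Fin n → Fin 3) → ℝ) :
    Ex p (fun χ => a * F χ) = a * Ex p F := by
  simp only [Ex, Finset.mul_sum]
  exact Finset.sum_congr rfl fun _ _ => by ring

lemma Ex_sum (p : ℝ) {n : ℕ} {ι : Type*} (s : Finset ι) (F : ι → (Fin n → Fin 3) → ℝ) :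
    Ex p (fun χ => ∑ i ∈ s, F i χ) = ∑ i ∈ s, Ex p (F i) := by
  simp only [Ex, Finset.mul_sum]
  exact Finset.sum_comm

lemma Ex_update (p : ℝ) {n : ℕ} (v : Fin n) (F : (Fin n → Fin 3) → ℝ) :
    Ex p F = Ex p (fun χ => ∑ c, cw p c * F (Function.update χ v c)) := by
  unfold Ex
  simp_rw [Finset.mul_sum]
  rw [← Fintype.sum_prod_type' (fun (χ : Fin n → Fin 3) (c : Fin 3) =>
    (∏ i, cw p (χ i)) * (cw p c * F (Function.update χ v c)))]
  let e : ((Fin n → Fin 3) × Fin 3) → ((Fin n → Fin 3) × Fin 3) :=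
    fun x => (Function.update x.1 v x.2, x.1 v)
  have he : Function.Involutive e := by
    rintro ⟨χ, c⟩
    simp [e]
  have key : ∀ (χ : Fin n → Fin 3) (c : Fin 3),
      (∏ i, cw p (χ i)) * cw p c = (∏ i, cw p (Function.update χ v c i)) * cw p (χ v) := by
    intro χ c
    rw [← Finset.mul_prod_erase _ (fun i => cw p (χ i)) (Finset.mem_univ v),
      ← Finset.mul_prod_erase _ (fun i => cw p (Function.update χ v c i)) (Finset.mem_univ v)]
    have : ∏ i ∈ Finset.univ.erase v, cw p (Function.update χ v c i)
        = ∏ i ∈ Finset.univ.erase v, cw p (χ i) :=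
      Finset.prod_congr rfl fun i hi => by
        rw [Function.update_of_ne (Finset.ne_of_mem_erase hi)]
    rw [this]; simp; ring
  have h1 : ∀ x : (Fin n → Fin 3) × Fin 3,
      (∏ i, cw p (x.1 i)) * (cw p x.2 * F (Function.update x.1 v x.2)) =
      (fun y : (Fin n → Fin 3) × Fin 3 => (∏ i, cw p (y.1 i)) * cw p y.2 * F y.1)
        (he.toPerm e x) := by
    rintro ⟨χ, c⟩
    simp only [Function.Involutive.coe_toPerm, e]
    rw [← key]; ring
  rw [Fintype.sum_congr _ _ h1, Equiv.sum_comp (he.toPerm e)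
    (fun y : (Fin n → Fin 3) × Fin 3 => (∏ i, cw p (y.1 i)) * cw p y.2 * F y.1), Fintype.sum_prod_type]
  refine Finset.sum_congr rfl fun χ _ => ?_
  dsimp only
  rw [← Finset.sum_mul, ← Finset.mul_sum, cw_sum, mul_one]

/-- Path estimate. -/
lemma path_bound {p : ℝ} (h0 : 0 < p) (h2 : p < 1 / 2) {n : ℕ} (H : (Fin n → Fin 3) → ℝ)
    (hH : ∀ χ, 0 ≤ H χ) (m : ℕ) (x : ℕ → Fin n)
    (hx : ∀ i ≤ m, ∀ j ≤ m, x i = x j → i = j)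
    (hfree : ∀ j ≤ m, ∀ χ c, H (Function.update χ (x j) c) = H χ) :
    ∀ k ≤ m,
      (Ex p (fun χ => H χ * ∏ j ∈ Finset.range k, Ac (χ (x j)) (χ (x (j+1))))
        ≤ (1 - p ^ 2 / (1 - p)) ^ k * Ex p H) ∧
      p / (1 - p) * Ex p (fun χ => H χ * ∏ j ∈ Finset.range k, Ac (χ (x j)) (χ (x (j+1))))
      ≤ Ex p (fun χ => (H χ * ∏ j ∈ Finset.range k, Ac (χ (x j)) (χ (x (j+1)))) * col (χ (x k))) := by
  have hq : 0 ≤ 1 - p ^ 2 / (1 - p) := by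
    rw [sub_nonneg, div_le_one (by linarith)]; nlinarith
  have hp1 : (0:ℝ) < 1 - p := by linarith
  intro k
  induction k with
  | zero =>
    intro hk
    simp only [Finset.range_zero, Finset.prod_empty, mul_one, pow_zero, one_mul, le_refl, true_and]
    rw [Ex_update p (x 0) (fun χ => H χ * col (χ (x 0)))]
    have : ∀ χ : Fin n → Fin 3, ∑ c, cw p c * (H (Function.update χ (x 0) c) *
        col (Function.update χ (x 0) c (x 0))) = 2 * p * H χ := by
      intro χ
      rw [← cw_col, Finset.sum_mul]
      refine Finset.sum_congr rfl fun c _ => ?_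
      rw [hfree 0 hk, Function.update_self]; ring
    simp_rw [this]
    rw [Ex_smul]
    have hE : 0 ≤ Ex p H := by
      have := Ex_mono h0 h2 hH
      simpa [Ex] using this
    refine mul_le_mul_of_nonneg_right ?_ hE
    rw [div_le_iff₀ hp1]; nlinarith
  | succ k ih =>
    intro hk
    obtain ⟨ih1, ih2⟩ := ih (by omega)
    set P : (Fin n → Fin 3) → ℝ :=
      fun χ => H χ * ∏ j ∈ Finset.range k, Ac (χ (x j)) (χ (x (j+1))) with hP
    have hP0 : ∀ χ, 0 ≤ P χ := fun χ =>
      mul_nonneg (hH χ) (Finset.prod_nonneg fun _ _ => Ac_nonneg _ _)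
    have hPu : ∀ χ c, P (Function.update χ (x (k+1)) c) = P χ := by
      intro χ c
      simp only [hP]
      rw [hfree _ hk]
      congr 1
      refine Finset.prod_congr rfl fun j hj => ?_
      have hj := Finset.mem_range.1 hj
      rw [Function.update_of_ne, Function.update_of_ne]
      · intro h; have := hx _ (by omega) _ hk h; omega
      · intro h; have := hx _ (by omega) _ hk h; omega
    have hne : x k ≠ x (k+1) := by
      intro h; have := hx _ (by omega) _ hk h; omega
    have hs : Ex p (fun χ => H χ * ∏ j ∈ Finset.range (k+1), Ac (χ (x j)) (χ (x (j+1))))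
        = Ex p P - p * Ex p (fun χ => P χ * col (χ (x k))) := by
      rw [Ex_update p (x (k+1)), ← Ex_smul, ← Ex_sub]
      congr 1; funext χ
      have : P χ - p * (P χ * col (χ (x k))) = P χ * (1 - p * col (χ (x k))) := by ring
      rw [this, ← cw_Ac, Finset.mul_sum]
      refine Finset.sum_congr rfl fun c _ => ?_
      rw [Finset.prod_range_succ, ← mul_assoc (H _)]
      change _ * (P (Function.update χ (x (k+1)) c) * _) = _
      rw [hPu, Function.update_self, Function.update_of_ne hne]; ring
    have ha : Ex p (fun χ => (H χ * ∏ j ∈ Finset.range (k+1), Ac (χ (x j)) (χ (x (j+1))))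
          * col (χ (x (k+1))))
        = 2 * p * Ex p P - p * Ex p (fun χ => P χ * col (χ (x k))) := by
      rw [Ex_update p (x (k+1)), ← Ex_smul, ← Ex_smul, ← Ex_sub]
      congr 1; funext χ
      have : 2 * p * P χ - p * (P χ * col (χ (x k))) = P χ * (2 * p - p * col (χ (x k))) := by ring
      rw [this, ← cw_Ac_col, Finset.mul_sum]
      refine Finset.sum_congr rfl fun c _ => ?_
      rw [Finset.prod_range_succ, ← mul_assoc (H _)]
      change _ * ((P (Function.update χ (x (k+1)) c) * _) * _) = _
      rw [hPu, Function.update_self, Function.update_of_ne hne]; ring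
    have hle : Ex p (fun χ => P χ * col (χ (x k))) ≤ Ex p P :=
      Ex_mono h0 h2 fun χ => mul_le_of_le_one_right (hP0 χ) (col_le_one _)
    rw [hs, ha]
    set s := Ex p P
    set a := Ex p (fun χ => P χ * col (χ (x k)))
    constructor
    · have h3 : s - p * a ≤ (1 - p ^ 2 / (1 - p)) * s := by
        have : p * (p / (1 - p) * s) ≤ p * a := mul_le_mul_of_nonneg_left ih2 h0.le
        have e : (1 - p ^ 2 / (1 - p)) * s = s - p * (p / (1 - p) * s) := by ring
        rw [e]; linarith
      rw [pow_succ']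
      calc _ ≤ _ := h3
        _ ≤ _ := by rw [mul_assoc]; exact mul_le_mul_of_nonneg_left ih1 hq
    · rw [div_mul_eq_mul_div, div_le_iff₀ hp1]
      have : 0 ≤ p * (1 - 2 * p) * (s - a) :=
        mul_nonneg (mul_nonneg h0.le (by linarith)) (by linarith)
      nlinarith

lemma invariant_bound {p : ℝ} (h0 : 0 < p) (h2 : p < 1 / 2) {n : ℕ} (g : Equiv.Perm (Fin n)) :
    ∀ (N : ℕ) (T : Finset (Fin n)), T.card ≤ N → (∀ i, g i ∈ T ↔ i ∈ T) → (∀ i ∈ T, g i ≠ i) →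
      Ex p (fun χ => ∏ i ∈ T, Ac (χ i) (χ (g i))) ≤
        Real.exp (-(T.card * (p ^ 2 / (2 * (1 - p))))) := by
  intro N
  induction N with
  | zero =>
    intro T hT _ _
    have : T = ∅ := by simpa using hT
    subst this
    simp [Ex_one]
  | succ N ih =>
    intro T hT hinv hmov
    rcases T.eq_empty_or_nonempty with rfl | ⟨x, hxT⟩
    · simp [Ex_one]
    set m := Function.minimalPeriod g x with hm
    have hmpos : 0 < m := by
      apply Function.minimalPeriod_pos_of_mem_periodicPts
      exact g.injective.mem_periodicPts x
    have hm1 : m ≠ 1 := by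
      intro h
      exact hmov x hxT (Function.minimalPeriod_eq_one_iff_isFixedPt.1 h)
    have hinj : ∀ i < m, ∀ j < m, g^[i] x = g^[j] x → i = j := by
      intro i hi j hj h
      exact Function.iterate_injOn_Iio_minimalPeriod hi hj h
    set O := (Finset.range m).image (fun j => g^[j] x) with hO
    have hOT : O ⊆ T := by
      intro y hy
      obtain ⟨j, _, rfl⟩ := Finset.mem_image.1 hy
      clear hy
      induction j with
      | zero => exact hxT
      | succ j ihj => rw [Function.iterate_succ_apply', hinv]; exact ihj (by simp at *; omega)
    have hOcard : O.card = m := by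
      rw [hO, Finset.card_image_of_injOn, Finset.card_range]
      intro i hi j hj h
      exact hinj i (by simpa using hi) j (by simpa using hj) h
    have hOmem : ∀ j, g^[j] x ∈ O := by
      intro j
      refine Finset.mem_image.2 ⟨j % m, Finset.mem_range.2 (Nat.mod_lt _ hmpos), ?_⟩
      exact Function.iterate_mod_minimalPeriod_eq
    have hOfwd : ∀ i ∈ O, g i ∈ O := by
      intro i hi
      obtain ⟨j, _, rfl⟩ := Finset.mem_image.1 hi
      have := hOmem (j+1)
      rwa [Function.iterate_succ_apply'] at this
    have hOinv : ∀ i, g i ∈ O ↔ i ∈ O := by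
      intro i
      refine ⟨fun h => ?_, hOfwd i⟩
      have himg : O.image g = O := by
        apply Finset.eq_of_subset_of_card_le
        · intro y hy
          obtain ⟨z, hz, rfl⟩ := Finset.mem_image.1 hy
          exact hOfwd z hz
        · rw [Finset.card_image_of_injective _ g.injective]
      rw [← himg] at h
      obtain ⟨z, hz, hzi⟩ := Finset.mem_image.1 h
      rwa [← g.injective hzi]
    have hcardsd : (T \ O).card + m = T.card := by
      rw [← hOcard]; exact Finset.card_sdiff_add_card_eq_card hOT
    have ihT := ih (T \ O) (by omega) (by intro i; simp [hinv, hOinv])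
      (by intro i hi; exact hmov i (Finset.mem_sdiff.1 hi).1)
    set H : (Fin n → Fin 3) → ℝ := fun χ => ∏ i ∈ T \ O, Ac (χ i) (χ (g i)) with hH
    have hpath := (path_bound h0 h2 H (fun χ => Finset.prod_nonneg fun _ _ => Ac_nonneg _ _)
      (m - 1) (fun j => g^[j] x)
      (fun i hi j hj h => hinj i (by omega) j (by omega) h)
      (by
        intro j hj χ c
        refine Finset.prod_congr rfl fun i hi => ?_
        have hi := (Finset.mem_sdiff.1 hi).2
        rw [Function.update_of_ne, Function.update_of_ne]
        · intro h; exact hi ((hOinv i).1 (h ▸ hOmem j))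
        · intro h; exact hi (h ▸ hOmem j)) (m - 1) le_rfl).1
    have hfull : Ex p (fun χ => ∏ i ∈ T, Ac (χ i) (χ (g i))) ≤
        Ex p (fun χ => H χ * ∏ j ∈ Finset.range (m-1), Ac (χ (g^[j] x)) (χ (g^[j+1] x))) := by
      apply Ex_mono h0 h2
      intro χ
      rw [← Finset.prod_sdiff hOT]
      refine mul_le_mul_of_nonneg_left ?_ (Finset.prod_nonneg fun _ _ => Ac_nonneg _ _)
      rw [hO, Finset.prod_image (fun i hi j hj h => hinj i (by simpa using hi) j (by simpa using hj) h)]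
      have hmm : m = (m - 1) + 1 := by omega
      rw [hmm, Finset.prod_range_succ]
      simp only [← Function.iterate_succ_apply' (f := g), Nat.add_sub_cancel]
      exact mul_le_of_le_one_right (Finset.prod_nonneg fun _ _ => Ac_nonneg _ _) (Ac_le_one _ _)
    have hp1 : (0:ℝ) < 1 - p := by linarith
    set c := p ^ 2 / (2 * (1 - p)) with hc
    have hc0 : 0 ≤ c := by positivity
    have hq : 0 ≤ 1 - p ^ 2 / (1 - p) := by
      rw [sub_nonneg, div_le_one (by linarith)]; nlinarith
    have hqc : 1 - p ^ 2 / (1 - p) ≤ Real.exp (-(2 * c)) := by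
      have : p ^ 2 / (1 - p) = 2 * c := by rw [hc]; field_simp
      rw [this]
      linarith [Real.add_one_le_exp (-(2 * c))]
    have hpow : (1 - p ^ 2 / (1 - p)) ^ (m - 1) ≤ Real.exp (-(m * c)) := by
      calc _ ≤ Real.exp (-(2 * c)) ^ (m - 1) := pow_le_pow_left₀ hq hqc _
        _ = Real.exp (((m - 1 : ℕ) : ℝ) * (-(2 * c))) := (Real.exp_nat_mul _ _).symm
        _ ≤ _ := by
          apply Real.exp_le_exp.2
          have h1 : (m : ℝ) ≤ 2 * ((m - 1 : ℕ) : ℝ) := by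
            have : m ≤ 2 * (m - 1) := by omega
            exact_mod_cast this
          nlinarith
    calc _ ≤ _ := hfull
      _ ≤ _ := hpath
      _ ≤ Real.exp (-(m * c)) * Real.exp (-((T \ O).card * c)) :=
        mul_le_mul hpow ihT (by
          have := Ex_mono h0 h2 (F := fun _ => 0) (G := H)
            (fun χ => Finset.prod_nonneg fun _ _ => Ac_nonneg _ _)
          simpa [Ex] using this) (Real.exp_pos _).le
      _ = _ := by
        rw [← Real.exp_add, ← hcardsd]; congr 1; push_cast; ring

open MeasureTheory ProbabilityTheory in
lemma two_point (q l : ℝ) (h0 : 0 ≤ q) (h1 : q ≤ 1) :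
    q * Real.exp (l * (1 - q)) + (1 - q) * Real.exp (l * (0 - q)) ≤ Real.exp (l ^ 2 / 8) := by
  let μ : Measure ℝ := ENNReal.ofReal q • Measure.dirac 1 + ENNReal.ofReal (1 - q) • Measure.dirac 0
  have hμ : IsProbabilityMeasure μ := ⟨by
    simp only [μ, Measure.coe_add, Measure.coe_smul, Pi.add_apply, Pi.smul_apply, measure_univ,
      smul_eq_mul, mul_one]
    rw [← ENNReal.ofReal_add h0 (by linarith)]; simp⟩
  have hintegral : ∀ f : ℝ → ℝ, ∫ x, f x ∂μ = q * f 1 + (1 - q) * f 0 := by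
    intro f
    have hi : ∀ a b : ℝ, Integrable f (ENNReal.ofReal a • Measure.dirac b) := fun a b =>
      (integrable_dirac (by simp)).smul_measure (by simp)
    rw [integral_add_measure (hi _ _) (hi _ _), integral_smul_measure, integral_smul_measure,
      integral_dirac, integral_dirac, ENNReal.toReal_ofReal h0, ENNReal.toReal_ofReal (by linarith)]
    simp
  have hb : ∀ᵐ x ∂μ, id x ∈ Set.Icc (0:ℝ) 1 := by
    simp only [μ]
    rw [ae_add_measure_iff]
    constructor <;> apply Measure.ae_smul_measure <;> simp [ae_dirac_eq]
  have h := (hasSubgaussianMGF_of_mem_Icc (μ := μ) (X := id) aemeasurable_id hb).mgf_le l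
  simp only [mgf, hintegral, id] at h
  have e : q * 1 + (1 - q) * 0 = q := by ring
  rw [e] at h
  refine h.trans (le_of_eq ?_)
  congr 1
  simp
  ring

lemma exists_label {n : ℕ} (χ : Fin n → Fin 3) : ∃ l : Equiv.Perm (Fin n),
    (∀ i, χ i = 0 → (l i : ℕ) + 1 ≤ (Finset.univ.filter fun j => χ j = 0).card) ∧
    (∀ i, χ i = 2 → n ≤ (l i : ℕ) + (Finset.univ.filter fun j => χ j = 2).card) := by
  have hmono := Tuple.monotone_sort χ
  set σ := Tuple.sort χ
  refine ⟨σ⁻¹, ?_, ?_⟩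
  · intro i hi
    have : ((Finset.Iic (σ⁻¹ i)).map σ.toEmbedding) ⊆ Finset.univ.filter fun j => χ j = 0 := by
      intro y hy
      obtain ⟨j, hj, rfl⟩ := Finset.mem_map.1 hy
      have := hmono (Finset.mem_Iic.1 hj)
      simp [hi] at this
      simpa using this
    have := Finset.card_le_card this
    rwa [Finset.card_map, Fin.card_Iic] at this
  · intro i hi
    have : ((Finset.Ici (σ⁻¹ i)).map σ.toEmbedding) ⊆ Finset.univ.filter fun j => χ j = 2 := by
      intro y hy
      obtain ⟨j, hj, rfl⟩ := Finset.mem_map.1 hy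
      have := hmono (Finset.mem_Ici.1 hj)
      simp [hi] at this
      simp
      omega
    have := Finset.card_le_card this
    rw [Finset.card_map, Fin.card_Ici] at this
    omega

lemma col_sum {n : ℕ} (χ : Fin n → Fin 3) : ∑ i, col (χ i) =
    ((Finset.univ.filter fun j => χ j = 0).card : ℝ) + (Finset.univ.filter fun j => χ j = 2).card := by
  rw [Finset.card_filter, Finset.card_filter]
  push_cast
  rw [← Finset.sum_add_distrib]
  refine Finset.sum_congr rfl fun i _ => ?_
  generalize χ i = a
  fin_cases a <;> simp [col]

theorem probabilistic_labeling_min_degree (n : ℕ) (C : Subgroup (Equiv.Perm (Fin n)))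
    (d : ℕ) (hdeg : ∀ g ∈ C, g ≠ 1 → d ≤ (Finset.univ.filter fun i : Fin n => g i ≠ i).card)
    (t p : ℝ) (ht : 0 < t) (hp0 : 0 < p) (hp2 : p < 1 / 2)
    (hsum : Real.exp (-(2 * t ^ 2) / n) +
      (Nat.card C : ℝ) * Real.exp (-(d * p ^ 2) / (2 * (1 - p))) < 1) :
    ∃ l : Equiv.Perm (Fin n), ∀ g ∈ C, g ≠ 1 →
      (n : ℝ) + 1 - (⌊2 * p * n + t⌋₊ : ℝ) ≤ (wt (l * g * l⁻¹) : ℝ) := by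
  classical
  rcases Nat.eq_zero_or_pos n with rfl | hn
  · exfalso
    simp at hsum
    have : 0 ≤ (Nat.card C : ℝ) * Real.exp (-(d * p ^ 2) / (2 * (1 - p))) := by positivity
    simp at this
    linarith
  have hnR : (0:ℝ) < n := by exact_mod_cast hn
  have hp1 : (0:ℝ) < 1 - p := by linarith
  set lam := 4 * t / n with hlam
  have hlam0 : 0 < lam := by positivity
  set S : Finset (Equiv.Perm (Fin n)) := Finset.univ.filter fun g => g ∈ C ∧ g ≠ 1 with hS
  set G : Equiv.Perm (Fin n) → (Fin n → Fin 3) → ℝ := fun g χ =>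
    ∏ i ∈ Finset.univ.filter (fun i => g i ≠ i), Ac (χ i) (χ (g i)) with hG
  have hG0 : ∀ g χ, 0 ≤ G g χ := fun g χ => Finset.prod_nonneg fun _ _ => Ac_nonneg _ _
  set Hf : (Fin n → Fin 3) → ℝ := fun χ =>
    Real.exp (-(lam * t)) * ∏ i, Real.exp (lam * (col (χ i) - 2 * p)) with hHf
  have hHE : Ex p Hf ≤ Real.exp (-(2 * t ^ 2) / n) := by
    rw [hHf, Ex_smul, Ex_prod p (fun c => Real.exp (lam * (col c - 2 * p)))]
    have h1 : ∑ c, cw p c * Real.exp (lam * (col c - 2 * p)) ≤ Real.exp (lam ^ 2 / 8) := by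
      refine le_trans (le_of_eq ?_) (two_point (2 * p) lam (by linarith) (by linarith))
      simp [cw, col, Fin.sum_univ_three]; ring
    calc _ ≤ Real.exp (-(lam * t)) * (Real.exp (lam ^ 2 / 8)) ^ n := by
          refine mul_le_mul_of_nonneg_left (pow_le_pow_left₀ ?_ h1 n) (Real.exp_pos _).le
          exact Finset.sum_nonneg fun c _ => mul_nonneg (cw_nonneg hp0 hp2 c) (Real.exp_pos _).le
      _ = _ := by
          rw [← Real.exp_nat_mul, ← Real.exp_add, hlam]
          congr 1; field_simp; ring
  have hGE : ∀ g ∈ S, Ex p (G g) ≤ Real.exp (-(d * p ^ 2) / (2 * (1 - p))) := by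
    intro g hg
    obtain ⟨-, hgC, hg1⟩ := Finset.mem_filter.1 hg
    refine (invariant_bound hp0 hp2 g _ _ le_rfl (by intro i; simp)
      (by intro i hi; simpa using hi)).trans ?_
    apply Real.exp_le_exp.2
    have h1 : (d : ℝ) ≤ ((Finset.univ.filter fun i : Fin n => g i ≠ i).card : ℝ) := by
      exact_mod_cast hdeg g hgC hg1
    rw [neg_div, mul_div_assoc]
    have : 0 ≤ p ^ 2 / (2 * (1 - p)) := by positivity
    exact neg_le_neg (mul_le_mul_of_nonneg_right h1 this)
  have hScard : (S.card : ℝ) ≤ Nat.card C := by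
    have h1 : S.card ≤ (Finset.univ.filter fun g => g ∈ C).card :=
      Finset.card_le_card (by intro g hg; simp [hS] at hg ⊢; exact hg.1)
    have h2 : Nat.card C = (Finset.univ.filter fun g => g ∈ C).card := by
      rw [Nat.card_eq_fintype_card, Fintype.card_subtype]
    rw [h2]; exact_mod_cast h1
  have htot : Ex p (fun χ => Hf χ + ∑ g ∈ S, G g χ) < 1 := by
    rw [Ex_add, Ex_sum]
    have h1 := Finset.sum_le_card_nsmul S _ _ hGE
    rw [nsmul_eq_mul] at h1
    have h2 := mul_le_mul_of_nonneg_right hScard (Real.exp_pos (-(d * p ^ 2) / (2 * (1 - p)))).le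
    linarith
  obtain ⟨χ, hχ⟩ : ∃ χ, Hf χ + ∑ g ∈ S, G g χ < 1 := by
    by_contra! hcon
    have := Ex_mono hp0 hp2 hcon
    rw [Ex_one] at this
    linarith
  have hHpos : 0 < Hf χ := mul_pos (Real.exp_pos _) (Finset.prod_pos fun _ _ => Real.exp_pos _)
  have hcount : ∑ i, col (χ i) ≤ 2 * p * n + t := by
    have h1 : Hf χ < 1 := by
      have := Finset.sum_nonneg (s := S) fun g _ => hG0 g χ
      linarith
    simp only [hHf] at h1
    rw [← Real.exp_sum, ← Real.exp_add, Real.exp_lt_one_iff, ← Finset.mul_sum,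
      Finset.sum_sub_distrib] at h1
    simp at h1
    by_contra! hc
    nlinarith
  obtain ⟨l, hl0, hl2⟩ := exists_label χ
  refine ⟨l, fun g hgC hg1 => ?_⟩
  have hgS : g ∈ S := by simp [hS, hgC, hg1]
  have hGlt : G g χ < 1 := by
    have := Finset.single_le_sum (f := fun g => G g χ) (fun g _ => hG0 g χ) hgS
    linarith
  obtain ⟨i, hi⟩ : ∃ i, (χ i = 0 ∧ χ (g i) = 2) ∨ (χ i = 2 ∧ χ (g i) = 0) := by
    by_contra! hcon
    refine absurd hGlt (not_lt.2 (le_of_eq ?_))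
    refine (Finset.prod_eq_one fun i _ => ?_).symm
    unfold Ac
    rw [if_neg]
    have := hcon i
    tauto
  rw [col_sum] at hcount
  have hfl : (Finset.univ.filter fun j => χ j = 0).card + (Finset.univ.filter fun j => χ j = 2).card
      ≤ ⌊2 * p * n + t⌋₊ := by
    apply Nat.le_floor
    push_cast
    exact hcount
  have hw : (((l * g * l⁻¹) (l i) : ℤ) - ((l i : Fin n) : ℤ)).natAbs ≤ wt (l * g * l⁻¹) :=
    Finset.le_sup (f := fun i : Fin n => (((l * g * l⁻¹) i : ℤ) - (i : ℤ)).natAbs)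
      (Finset.mem_univ (l i))
  have hlg : (l * g * l⁻¹) (l i) = l (g i) := by simp
  rw [hlg] at hw
  have hfin : n + 1 ≤ wt (l * g * l⁻¹) + ⌊2 * p * n + t⌋₊ := by
    rcases hi with ⟨ha, hb⟩ | ⟨ha, hb⟩
    · have := hl0 _ ha
      have := hl2 _ hb
      omega
    · have := hl2 _ ha
      have := hl0 _ hb
      omega
  have : (n : ℝ) + 1 ≤ wt (l * g * l⁻¹) + ⌊2 * p * n + t⌋₊ := by exact_mod_cast hfin
  linarith
end

section
/- For all sufficiently large primes q, there exists a labeling l ∈ S_q such that the conjugate group l · AGL(q) · l^{-1} has minimal ℓ∞-distance at least q − c·√(q ln q) for some absolute constant c > 0 (one may take the bound q − 2q·√(4 ln(q+1)/(q−1)) − √(q ln(q+1))). -/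
/-- The ℓ∞-weight of a permutation of `ZMod q`, using integer representatives. -/
def wtZ (q : ℕ) [NeZero q] (f : Equiv.Perm (ZMod q)) : ℕ :=
  Finset.univ.sup fun x : ZMod q => (((f x).val : ℤ) - ((x).val : ℤ)).natAbs

/-- `f` is an affine permutation `x ↦ a x + b` with `a ≠ 0`, i.e. an element of `AGL(q)`. -/
def IsAffine (q : ℕ) (f : Equiv.Perm (ZMod q)) : Prop :=
  ∃ a b : ZMod q, a ≠ 0 ∧ ∀ x : ZMod q, f x = a * x + b

lemma agl_exists_indep {V : Type*} [Fintype V] [DecidableEq V] (f : Equiv.Perm V)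
    (hf : ∀ x y, f x = x → f y = y → x = y) :
    ∃ S : Finset V, (∀ x ∈ S, f x ∉ S) ∧ Fintype.card V ≤ 3 * S.card + 1 := by
  classical
  obtain ⟨S, hS, hmax⟩ := Finset.exists_max_image
    (Finset.univ.filter fun S : Finset V => ∀ x ∈ S, f x ∉ S) Finset.card ⟨∅, by simp⟩
  simp only [Finset.mem_filter, Finset.mem_univ, true_and] at hS hmax
  refine ⟨S, hS, ?_⟩
  have hcov : (Finset.univ : Finset V) ⊆
      ((S ∪ S.image f) ∪ S.image f.symm) ∪ Finset.univ.filter (fun x => f x = x) := by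
    intro y _
    by_contra hy
    simp only [Finset.mem_union, Finset.mem_image, Finset.mem_filter, Finset.mem_univ, true_and,
      not_or, not_exists, not_and] at hy
    obtain ⟨⟨⟨h1, h2⟩, h3⟩, h4⟩ := hy
    have := hmax (insert y S) (by
      intro x hx hfx
      rw [Finset.mem_insert] at hx hfx
      rcases hx with rfl | hx
      · rcases hfx with hfx | hfx
        · exact h4 hfx
        · exact h3 _ hfx (by simp)
      · rcases hfx with hfx | hfx
        · exact h2 x hx hfx
        · exact hS x hx hfx)
    rw [Finset.card_insert_of_notMem h1] at this
    omega
  have h1 := Finset.card_le_card hcov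
  have hfix : (Finset.univ.filter (fun x => f x = x)).card ≤ 1 := by
    rw [Finset.card_le_one]
    intro a ha b hb
    simp at ha hb
    exact hf a b ha hb
  have h2 := Finset.card_union_le ((S ∪ S.image f) ∪ S.image f.symm)
    (Finset.univ.filter (fun x => f x = x))
  have h3 := Finset.card_union_le (S ∪ S.image f) (S.image f.symm)
  have h4 := Finset.card_union_le S (S.image f)
  have h5 : (S.image f).card ≤ S.card := Finset.card_image_le
  have h6 : (S.image f.symm).card ≤ S.card := Finset.card_image_le
  rw [Finset.card_univ] at h1
  omega

lemma agl_card_bad {V K : Type*} [Fintype V] [DecidableEq V] [Fintype K] [DecidableEq K]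
    (k0 k1 : K) (hk : k0 ≠ k1) (f : Equiv.Perm V) (S : Finset V) (hS : ∀ x ∈ S, f x ∉ S) :
    (Finset.univ.filter fun c : V → K => ∀ x, ¬ ((c x = k0 ∧ c (f x) = k1) ∨
      (c x = k1 ∧ c (f x) = k0))).card * Fintype.card K ^ (2 * S.card)
      ≤ (Fintype.card K ^ 2 - 2) ^ S.card * Fintype.card K ^ Fintype.card V := by
  classical
  let G := {p : K × K // p ∉ ({(k0, k1), (k1, k0)} : Finset (K × K))}
  have hG : Fintype.card G = Fintype.card K ^ 2 - 2 := by
    rw [Fintype.card_subtype_compl, Fintype.card_prod, sq]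
    congr 1
    rw [Fintype.card_coe, Finset.card_pair]
    intro h
    exact hk (Prod.ext_iff.1 h).1
  let R := {v : V // v ∉ S ∪ S.image f}
  have hdis : Disjoint S (S.image f) := by
    rw [Finset.disjoint_left]
    intro a ha hb
    obtain ⟨x, hx, rfl⟩ := Finset.mem_image.1 hb
    exact hS x hx ha
  have hU : (S ∪ S.image f).card = 2 * S.card := by
    rw [Finset.card_union_of_disjoint hdis, Finset.card_image_of_injective _ f.injective]
    ring
  have hR : Fintype.card R + 2 * S.card = Fintype.card V := by
    have : Fintype.card R = Fintype.card V - 2 * S.card := by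
      rw [Fintype.card_subtype_compl, Fintype.card_coe, hU]
    have h2 := Finset.card_le_univ (S ∪ S.image f)
    omega
  have key : (Finset.univ.filter fun c : V → K => ∀ x, ¬ ((c x = k0 ∧ c (f x) = k1) ∨
      (c x = k1 ∧ c (f x) = k0))).card ≤ Fintype.card ((S → G) × (R → K)) := by
    rw [← Fintype.card_coe]
    refine Fintype.card_le_of_injective
      (fun c => (fun x => ⟨(c.1 x, c.1 (f x)), ?_⟩, fun v => c.1 v)) ?_
    · have := (Finset.mem_filter.1 c.2).2 x
      simpa [Prod.ext_iff] using this
    · intro c d h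
      apply Subtype.ext
      funext v
      rw [Prod.mk.injEq] at h
      obtain ⟨h1, h2⟩ := h
      by_cases hv : v ∈ S ∪ S.image f
      · rcases Finset.mem_union.1 hv with hv | hv
        · have := congrFun h1 ⟨v, hv⟩
          simp only [Subtype.mk.injEq, Prod.mk.injEq] at this
          exact this.1
        · obtain ⟨x, hx, rfl⟩ := Finset.mem_image.1 hv
          have := congrFun h1 ⟨x, hx⟩
          simp only [Subtype.mk.injEq, Prod.mk.injEq] at this
          exact this.2
      · exact congrFun h2 ⟨v, hv⟩
  rw [Fintype.card_prod, Fintype.card_fun, Fintype.card_fun, hG, Fintype.card_coe] at key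
  calc _ ≤ ((Fintype.card K ^ 2 - 2) ^ S.card * Fintype.card K ^ Fintype.card R)
        * Fintype.card K ^ (2 * S.card) := Nat.mul_le_mul_right _ key
    _ = _ := by rw [mul_assoc, ← pow_add, hR]

lemma agl_card_bad_real {V K : Type*} [Fintype V] [DecidableEq V] [Fintype K] [DecidableEq K]
    (k0 k1 : K) (hk : k0 ≠ k1) (f : Equiv.Perm V)
    (hf : ∀ x y, f x = x → f y = y → x = y) :
    ((Finset.univ.filter fun c : V → K => ∀ x, ¬ ((c x = k0 ∧ c (f x) = k1) ∨
      (c x = k1 ∧ c (f x) = k0))).card : ℝ)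
      ≤ Real.exp (-(2 * ((Fintype.card V : ℝ) - 1) / (3 * (Fintype.card K : ℝ) ^ 2))) *
        (Fintype.card K : ℝ) ^ Fintype.card V := by
  obtain ⟨S, hS, hc⟩ := agl_exists_indep f hf
  have h := agl_card_bad k0 k1 hk f S hS
  set X := (Finset.univ.filter fun c : V → K => ∀ x, ¬ ((c x = k0 ∧ c (f x) = k1) ∨
      (c x = k1 ∧ c (f x) = k0))).card
  have hN : 2 ≤ Fintype.card K := by
    have := Finset.card_le_univ ({k0, k1} : Finset K)
    rwa [Finset.card_pair hk] at this
  generalize Fintype.card K = N at *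
  generalize Fintype.card V = n at *
  have h2 : 2 ≤ N ^ 2 := by nlinarith
  have hr : (X : ℝ) * (N : ℝ) ^ (2 * S.card) ≤ ((N : ℝ) ^ 2 - 2) ^ S.card * (N : ℝ) ^ n := by
    have : ((X * N ^ (2 * S.card) : ℕ) : ℝ) ≤ ((N ^ 2 - 2) ^ S.card * N ^ n : ℕ) := by
      exact_mod_cast h
    push_cast [Nat.cast_sub h2] at this
    exact this
  have hN0 : (0 : ℝ) < N := by positivity
  have hstep : ((N : ℝ) ^ 2 - 2) ^ S.card ≤
      Real.exp (-(2 * ((n : ℝ) - 1) / (3 * (N : ℝ) ^ 2))) * (N : ℝ) ^ (2 * S.card) := by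
    have h2r : (2 : ℝ) ≤ (N : ℝ) ^ 2 := by exact_mod_cast h2
    have e1 : (N : ℝ) ^ 2 - 2 ≤ Real.exp (-(2 / (N : ℝ) ^ 2)) * (N : ℝ) ^ 2 := by
      have := Real.add_one_le_exp (-(2 / (N : ℝ) ^ 2))
      calc (N : ℝ) ^ 2 - 2 = (-(2 / (N : ℝ) ^ 2) + 1) * (N : ℝ) ^ 2 := by field_simp; ring
        _ ≤ _ := by gcongr
    calc ((N : ℝ) ^ 2 - 2) ^ S.card
        ≤ (Real.exp (-(2 / (N : ℝ) ^ 2)) * (N : ℝ) ^ 2) ^ S.card :=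
          pow_le_pow_left₀ (by linarith) e1 _
      _ = Real.exp (S.card * (-(2 / (N : ℝ) ^ 2))) * (N : ℝ) ^ (2 * S.card) := by
          rw [mul_pow, ← Real.exp_nat_mul, ← pow_mul]
      _ ≤ _ := by
          gcongr
          have hcr : (n : ℝ) ≤ 3 * S.card + 1 := by exact_mod_cast hc
          have : 2 * ((n : ℝ) - 1) / (3 * (N : ℝ) ^ 2) ≤ S.card * (2 / (N : ℝ) ^ 2) := by
            rw [mul_div_assoc', div_le_div_iff₀ (by positivity) (by positivity)]
            nlinarith [sq_nonneg (N : ℝ)]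
          linarith
  have hp : (0 : ℝ) < (N : ℝ) ^ (2 * S.card) := by positivity
  refine le_of_mul_le_mul_right ?_ hp
  calc _ ≤ _ := hr
    _ ≤ _ * (N : ℝ) ^ n := mul_le_mul_of_nonneg_right hstep (by positivity)
    _ = _ := by ring

lemma agl_card_big {V K : Type*} [Fintype V] [DecidableEq V] [Fintype K] [DecidableEq K]
    (k0 k1 : K) (hk : k0 ≠ k1) (M : ℝ) :
    M * ((Finset.univ.filter fun c : V → K =>
      M ≤ ((Finset.univ.filter fun v => c v = k0 ∨ c v = k1).card : ℝ)).card : ℝ)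
      * Fintype.card K ≤ 2 * Fintype.card V * (Fintype.card K : ℝ) ^ Fintype.card V := by
  classical
  have hv : ∀ v : V, ((Finset.univ.filter fun c : V → K => c v = k0 ∨ c v = k1).card)
      * Fintype.card K = 2 * Fintype.card K ^ Fintype.card V := by
    intro v
    have he : (Finset.univ.filter fun c : V → K => c v = k0 ∨ c v = k1) =
        Fintype.piFinset (Function.update (fun _ => (Finset.univ : Finset K)) v {k0, k1}) := by
      ext c
      simp only [Finset.mem_filter, Finset.mem_univ, true_and, Fintype.mem_piFinset]
      constructor
      · intro h a
        by_cases ha : a = v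
        · subst ha; simpa using h
        · simp [ha]
      · intro h
        simpa using h v
    have hpos : 0 < Fintype.card V := Fintype.card_pos_iff.2 ⟨v⟩
    rw [he, Fintype.card_piFinset, ← Finset.mul_prod_erase _ _ (Finset.mem_univ v)]
    rw [Finset.prod_congr rfl (g := fun _ => Fintype.card K)]
    · simp only [Function.update_self, Finset.card_pair hk, Finset.prod_const,
        Finset.card_erase_of_mem (Finset.mem_univ v), Finset.card_univ]
      rw [mul_assoc, ← pow_succ, Nat.sub_add_cancel hpos]
    · intro x hx
      rw [Function.update_of_ne (Finset.ne_of_mem_erase hx), Finset.card_univ]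
  have hsum : (∑ c : V → K, (Finset.univ.filter fun v => c v = k0 ∨ c v = k1).card)
      * Fintype.card K = 2 * Fintype.card V * Fintype.card K ^ Fintype.card V := by
    simp_rw [Finset.card_filter]
    rw [Finset.sum_comm]
    simp_rw [← Finset.card_filter]
    rw [Finset.sum_mul, Finset.sum_congr rfl (fun v _ => hv v)]
    simp
    ring
  have hsumr : (∑ c : V → K, ((Finset.univ.filter fun v => c v = k0 ∨ c v = k1).card : ℝ))
      * Fintype.card K = 2 * Fintype.card V * (Fintype.card K : ℝ) ^ Fintype.card V := by
    exact_mod_cast hsum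
  rw [← hsumr]
  gcongr
  calc _ = ∑ c ∈ (Finset.univ.filter fun c : V → K =>
      M ≤ ((Finset.univ.filter fun v => c v = k0 ∨ c v = k1).card : ℝ)), M := by
        rw [Finset.sum_const, nsmul_eq_mul, mul_comm]
    _ ≤ ∑ c ∈ (Finset.univ.filter fun c : V → K =>
      M ≤ ((Finset.univ.filter fun v => c v = k0 ∨ c v = k1).card : ℝ)),
        ((Finset.univ.filter fun v => c v = k0 ∨ c v = k1).card : ℝ) :=
        Finset.sum_le_sum fun c hc => (Finset.mem_filter.1 hc).2
    _ ≤ _ := Finset.sum_le_sum_of_subset_of_nonneg (Finset.filter_subset _ _)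
        (fun _ _ _ => by positivity)

lemma agl_exists_coloring {V K : Type*} [Fintype V] [DecidableEq V] [Fintype K] [DecidableEq K]
    (k0 k1 : K) (hk : k0 ≠ k1) (F : Finset (Equiv.Perm V))
    (hF : ∀ f ∈ F, ∀ x y, f x = x → f y = y → x = y) (M : ℝ) (hM : 0 < M)
    (h : 2 * (Fintype.card V : ℝ) / (M * Fintype.card K) + F.card *
      Real.exp (-(2 * ((Fintype.card V : ℝ) - 1) / (3 * (Fintype.card K : ℝ) ^ 2))) < 1) :
    ∃ c : V → K, ((Finset.univ.filter fun v => c v = k0 ∨ c v = k1).card : ℝ) < M ∧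
      ∀ f ∈ F, ∃ x, ((c x = k0 ∧ c (f x) = k1) ∨ (c x = k1 ∧ c (f x) = k0)) := by
  classical
  by_contra! hcon
  have hcov : (Finset.univ : Finset (V → K)) ⊆ (Finset.univ.filter fun c : V → K =>
      M ≤ ((Finset.univ.filter fun v => c v = k0 ∨ c v = k1).card : ℝ)) ∪
      F.biUnion fun f => (Finset.univ.filter fun c : V → K => ∀ x, ¬ ((c x = k0 ∧ c (f x) = k1) ∨
      (c x = k1 ∧ c (f x) = k0))) := by
    intro c _
    rw [Finset.mem_union]
    by_cases hc : ((Finset.univ.filter fun v => c v = k0 ∨ c v = k1).card : ℝ) < M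
    · right
      obtain ⟨f, hf, hx⟩ := hcon c hc
      refine Finset.mem_biUnion.2 ⟨f, hf, Finset.mem_filter.2 ⟨Finset.mem_univ _, ?_⟩⟩
      intro x hx'
      have := hx x
      tauto
    · left
      exact Finset.mem_filter.2 ⟨Finset.mem_univ _, not_lt.1 hc⟩
  have h1 := (Finset.card_le_card hcov).trans (Finset.card_union_le _ _)
  have h2 := Finset.card_biUnion_le (s := F) (t := fun f => (Finset.univ.filter fun c : V → K =>
    ∀ x, ¬ ((c x = k0 ∧ c (f x) = k1) ∨ (c x = k1 ∧ c (f x) = k0))))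
  rw [Finset.card_univ, Fintype.card_fun] at h1
  have h3 := agl_card_big (V := V) k0 k1 hk M
  have h4 := Finset.sum_le_sum fun f hf => agl_card_bad_real k0 k1 hk f (hF f hf)
  rw [Finset.sum_const, nsmul_eq_mul] at h4
  have hK : (0 : ℝ) < Fintype.card K := by
    exact_mod_cast Fintype.card_pos_iff.2 ⟨k0⟩
  have h3' : ((Finset.univ.filter fun c : V → K =>
      M ≤ ((Finset.univ.filter fun v => c v = k0 ∨ c v = k1).card : ℝ)).card : ℝ) ≤
      2 * (Fintype.card V : ℝ) / (M * Fintype.card K) *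
        (Fintype.card K : ℝ) ^ Fintype.card V := by
    rw [div_mul_eq_mul_div, le_div_iff₀ (by positivity)]
    linarith
  have h5 := h1.trans (Nat.add_le_add_left h2 _)
  have h6 := (Nat.cast_le (α := ℝ)).2 h5
  push_cast at h6
  have hpos : (0 : ℝ) < (Fintype.card K : ℝ) ^ Fintype.card V := by positivity
  nlinarith

lemma agl_exists_label (q : ℕ) [NeZero q] (A B : Finset (ZMod q)) (hAB : Disjoint A B) :
    ∃ l : Equiv.Perm (ZMod q), (∀ a ∈ A, (l a).val < A.card) ∧
      ∀ b ∈ B, q ≤ (l b).val + B.card := by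
  classical
  have hcard : A.card + B.card ≤ q := by
    rw [← Finset.card_union_of_disjoint hAB]
    simpa [ZMod.card] using Finset.card_le_univ (A ∪ B)
  let f : ZMod q → ℕ := fun x => if h : x ∈ A then (A.equivFin ⟨x, h⟩ : ℕ) else
    if h : x ∈ B then q - 1 - (B.equivFin ⟨x, h⟩ : ℕ) else 0
  have hfA : ∀ x (h : x ∈ A), f x = (A.equivFin ⟨x, h⟩ : ℕ) := fun x h => by simp [f, h]
  have hfB : ∀ x (h : x ∈ B), f x = q - 1 - (B.equivFin ⟨x, h⟩ : ℕ) := fun x h => by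
    have : x ∉ A := fun h' => Finset.disjoint_left.1 hAB h' h
    simp [f, h, this]
  obtain ⟨g, hg⟩ := Finset.exists_equiv_extend_of_card_eq (α := ZMod q) (t := Finset.range q)
    (by simp [ZMod.card]) (s := A ∪ B) (f := f)
    (by
      intro y hy
      obtain ⟨x, hx, rfl⟩ := Finset.mem_image.1 hy
      rw [Finset.mem_range]
      rcases Finset.mem_union.1 hx with hx | hx
      · rw [hfA x hx]; have := (A.equivFin ⟨x, hx⟩).2; omega
      · rw [hfB x hx]; have := (B.equivFin ⟨x, hx⟩).2; omega)
    (by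
      intro x hx y hy hxy
      rcases Finset.mem_union.1 hx with hx | hx <;> rcases Finset.mem_union.1 hy with hy | hy
      · rw [hfA x hx, hfA y hy] at hxy
        simpa using A.equivFin.injective (Fin.ext hxy)
      · rw [hfA x hx, hfB y hy] at hxy
        have := (A.equivFin ⟨x, hx⟩).2
        have := (B.equivFin ⟨y, hy⟩).2
        omega
      · rw [hfB x hx, hfA y hy] at hxy
        have := (A.equivFin ⟨y, hy⟩).2
        have := (B.equivFin ⟨x, hx⟩).2
        omega
      · rw [hfB x hx, hfB y hy] at hxy
        have h1 := (B.equivFin ⟨x, hx⟩).2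
        have h2 := (B.equivFin ⟨y, hy⟩).2
        have : (B.equivFin ⟨x, hx⟩ : ℕ) = (B.equivFin ⟨y, hy⟩ : ℕ) := by omega
        simpa using B.equivFin.injective (Fin.ext this))
  have hval : ∀ x, (((g x : ℕ) : ZMod q)).val = (g x : ℕ) := fun x =>
    ZMod.val_cast_of_lt (Finset.mem_range.1 (g x).2)
  have hinj : Function.Injective (fun x => (((g x : ℕ) : ZMod q))) := by
    intro x y hxy
    have := congrArg ZMod.val hxy
    simp only [hval] at this
    exact g.injective (Subtype.ext this)
  refine ⟨Equiv.ofBijective _ (Finite.injective_iff_bijective.1 hinj), ?_, ?_⟩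
  · intro a ha
    rw [Equiv.ofBijective_apply, hval, hg a (Finset.mem_union_left _ ha), hfA a ha]
    exact (A.equivFin ⟨a, ha⟩).2
  · intro b hb
    rw [Equiv.ofBijective_apply, hval, hg b (Finset.mem_union_right _ hb), hfB b hb]
    have := (B.equivFin ⟨b, hb⟩).2
    omega

lemma agl_fixed (q : ℕ) (hq : q.Prime) (f : Equiv.Perm (ZMod q)) (hf : IsAffine q f)
    (h1 : f ≠ 1) : ∀ x y, f x = x → f y = y → x = y := by
  have := Fact.mk hq
  obtain ⟨a, b, _, h⟩ := hf
  intro x y hx hy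
  by_contra hxy
  rw [h] at hx hy
  have h2 : (a - 1) * (x - y) = 0 := by linear_combination hx - hy
  rcases mul_eq_zero.1 h2 with h3 | h3
  · apply h1
    have ha : a = 1 := sub_eq_zero.1 h3
    subst ha
    have hb : b = 0 := by linear_combination hx
    ext z
    simp [h, hb]
  · exact hxy (sub_eq_zero.1 h3)

open Classical in
lemma agl_card_affine (q : ℕ) [NeZero q] :
    (Finset.univ.filter fun f : Equiv.Perm (ZMod q) => IsAffine q f ∧ f ≠ 1).card ≤ q ^ 2 := by
  have : (Finset.univ : Finset (ZMod q × ZMod q)).card = q ^ 2 := by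
    simp [ZMod.card, sq]
  rw [← this]
  refine Finset.card_le_card_of_injOn (fun f => (f 0, f 1)) (fun _ _ => Finset.mem_coe.2 (Finset.mem_univ _)) ?_
  intro f hf g hg h
  simp only [Finset.coe_filter, Finset.mem_univ, true_and, Set.mem_ofPred_eq] at hf hg
  obtain ⟨⟨a, b, _, hf⟩, _⟩ := hf
  obtain ⟨⟨a', b', _, hg⟩, _⟩ := hg
  simp only [hf, hg, Prod.mk.injEq] at h
  obtain ⟨h0, h1⟩ := h
  have hb : b = b' := by linear_combination h0
  have ha : a = a' := by linear_combination h1 - h0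
  ext z
  rw [hf, hg, ha, hb]

lemma agl_numeric (q : ℕ) (hL : 10 ≤ Real.log ((q : ℝ) + 1))
    (hqL : 400 * Real.log ((q : ℝ) + 1) ≤ q) :
    ∃ N : ℕ, 2 ≤ N ∧
     2 * (q : ℝ) / ((2 * q * Real.sqrt (4 * Real.log (q + 1) / (q - 1)) +
            Real.sqrt (q * Real.log (q + 1))) * N) + (q : ℝ) ^ 2 *
      Real.exp (-(2 * ((q : ℝ) - 1) / (3 * (N : ℝ) ^ 2))) < 1 := by
  set L := Real.log ((q : ℝ) + 1) with hLdef
  have hq : (4000 : ℝ) ≤ q := by linarith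
  set r := Real.sqrt (q / L) with hr
  have hLpos : 0 < L := by linarith
  have hr2 : r ^ 2 = q / L := Real.sq_sqrt (by positivity)
  have hr20 : 20 ≤ r := by
    apply Real.le_sqrt_of_sq_le
    rw [le_div_iff₀ hLpos]; linarith
  have hrL : r ^ 2 * L = q := by rw [hr2]; field_simp
  have hs2 : Real.sqrt (q * L) = r * L := by
    rw [← hrL, show r ^ 2 * L * L = (r * L) ^ 2 by ring, Real.sqrt_sq (by positivity)]
  have hs1 : 2 / r ≤ Real.sqrt (4 * L / (q - 1)) := by
    apply Real.le_sqrt_of_sq_le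
    rw [div_pow, hr2, div_div_eq_mul_div, div_le_div_iff₀ (by linarith) (by linarith)]
    nlinarith
  have hM : 5 * (r * L) ≤ 2 * q * Real.sqrt (4 * L / (q - 1)) + Real.sqrt (q * L) := by
    rw [hs2]
    have : 2 * (q : ℝ) * (2 / r) = 4 * (r * L) := by
      rw [← hrL]; field_simp; norm_num
    nlinarith
  refine ⟨⌊r / 2⌋₊, Nat.le_floor (by push_cast; linarith), ?_⟩
  have hN1 : (⌊r / 2⌋₊ : ℝ) ≤ r / 2 := Nat.floor_le (by linarith)
  have hN2 : r / 2 < (⌊r / 2⌋₊ : ℝ) + 1 := Nat.lt_floor_add_one _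
  generalize (⌊r / 2⌋₊ : ℝ) = N at *
  have hN3 : 9 / 20 * r ≤ N := by linarith
  have hNpos : 0 < N := by linarith
  have t1 : 2 * (q : ℝ) / ((2 * q * Real.sqrt (4 * L / (q - 1)) + Real.sqrt (q * L)) * N)
      ≤ 8 / 9 := by
    have hrLpos : 0 < r * L := by positivity
    rw [div_le_div_iff₀ (mul_pos (by linarith) hNpos) (by norm_num)]
    have : 5 * (r * L) * (9 / 20 * r) ≤
      (2 * q * Real.sqrt (4 * L / (q - 1)) + Real.sqrt (q * L)) * N := by
      apply mul_le_mul hM hN3 (by positivity) (by linarith)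
    nlinarith
  have t2 : 5 / 2 * L ≤ 2 * ((q : ℝ) - 1) / (3 * N ^ 2) := by
    rw [le_div_iff₀ (by positivity)]
    have : N ^ 2 ≤ r ^ 2 / 4 := by nlinarith
    have : N ^ 2 * L ≤ r ^ 2 / 4 * L := by gcongr
    nlinarith
  have t3 : (q : ℝ) ^ 2 ≤ Real.exp (2 * L) := by
    rw [two_mul, Real.exp_add, hLdef, Real.exp_log (by linarith)]
    nlinarith
  have t4 : (q : ℝ) ^ 2 * Real.exp (-(2 * ((q : ℝ) - 1) / (3 * N ^ 2))) < 1 / 9 := by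
    calc _ ≤ Real.exp (2 * L) * Real.exp (-(5 / 2 * L)) := by gcongr
      _ = Real.exp (-(L / 2)) := by rw [← Real.exp_add]; congr 1; ring
      _ ≤ Real.exp (-5) := by gcongr; linarith
      _ < 1 / 9 := by
        rw [Real.exp_neg, one_div]
        apply inv_strictAnti₀ (by norm_num)
        have := Real.exp_one_gt_d9
        have h5 : Real.exp 5 = Real.exp 1 ^ 5 := by
          rw [← Real.exp_nat_mul]; norm_num
        rw [h5]
        calc (9 : ℝ) < 2 ^ 5 := by norm_num
          _ ≤ _ := by gcongr; linarith
  linarith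

lemma agl_eventually : ∃ N : ℕ, ∀ q : ℕ, N ≤ q → 10 ≤ Real.log ((q : ℝ) + 1) ∧
    400 * Real.log ((q : ℝ) + 1) ≤ q := by
  have ht : Filter.Tendsto (fun q : ℕ => (q : ℝ) + 1) Filter.atTop Filter.atTop :=
    Filter.tendsto_atTop_add_const_right _ _ tendsto_natCast_atTop_atTop
  have h1 := (Real.tendsto_log_atTop.comp ht).eventually_ge_atTop 10
  have h2 := ht.eventually (Real.isLittleO_log_id_atTop.bound (c := 1 / 800) (by norm_num))
  obtain ⟨N, hN⟩ := Filter.eventually_atTop.1 (h1.and h2)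
  refine ⟨max N 1, fun q hq => ?_⟩
  obtain ⟨a, b⟩ := hN q (le_trans (le_max_left _ _) hq)
  have hq1 : (1 : ℝ) ≤ q := by exact_mod_cast le_trans (le_max_right _ _) hq
  refine ⟨a, ?_⟩
  simp only [Function.comp, id, Real.norm_eq_abs] at a b
  rw [abs_of_nonneg (by linarith), abs_of_nonneg (by linarith)] at b
  linarith

/-- For all sufficiently large primes `q`, some labeling `l` makes every non-identity
element of `l · AGL(q) · l⁻¹` have ℓ∞-weight at least
`q - 2q·√(4 ln(q+1)/(q-1)) - √(q ln(q+1))`, which is `q - O(√(q ln q))`. -/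
theorem agl_labeling_lower_bound :
    ∃ N : ℕ, ∀ q : ℕ, q.Prime → N ≤ q → ∀ (_ : NeZero q),
      ∃ l : Equiv.Perm (ZMod q),
        ∀ f : Equiv.Perm (ZMod q), IsAffine q f → f ≠ 1 →
          (q : ℝ) - 2 * q * Real.sqrt (4 * Real.log (q + 1) / (q - 1)) -
            Real.sqrt (q * Real.log (q + 1)) ≤ (wtZ q (l * f * l⁻¹) : ℝ) := by
  classical
  obtain ⟨N₀, hN₀⟩ := agl_eventually
  refine ⟨N₀, fun q hq hqN _ => ?_⟩
  obtain ⟨hL, hqL⟩ := hN₀ q hqN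
  obtain ⟨N, hN, hnum⟩ := agl_numeric q hL hqL
  set M := 2 * (q : ℝ) * Real.sqrt (4 * Real.log (q + 1) / (q - 1)) +
            Real.sqrt (q * Real.log (q + 1)) with hM
  have hMpos : 0 < M := by
    have hqpos : (0 : ℝ) < q := by exact_mod_cast hq.pos
    have : 0 < Real.sqrt (q * Real.log (q + 1)) := Real.sqrt_pos.2 (by positivity)
    positivity
  let k0 : Fin N := ⟨0, by omega⟩
  let k1 : Fin N := ⟨1, by omega⟩
  have hk : k0 ≠ k1 := by simp [k0, k1]
  let F := Finset.univ.filter fun f : Equiv.Perm (ZMod q) => IsAffine q f ∧ f ≠ 1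
  have hFc : (F.card : ℝ) ≤ (q : ℝ) ^ 2 := by exact_mod_cast agl_card_affine q
  obtain ⟨c, hc1, hc2⟩ := agl_exists_coloring k0 k1 hk F
    (fun f hf => agl_fixed q hq f (Finset.mem_filter.1 hf).2.1 (Finset.mem_filter.1 hf).2.2)
    M hMpos (by
      rw [ZMod.card, Fintype.card_fin]
      refine lt_of_le_of_lt ?_ hnum
      gcongr)
  let A := Finset.univ.filter fun v => c v = k0
  let B := Finset.univ.filter fun v => c v = k1
  have hAB : Disjoint A B := by
    rw [Finset.disjoint_left]
    intro v ha hb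
    exact hk ((Finset.mem_filter.1 ha).2.symm.trans (Finset.mem_filter.1 hb).2)
  have hcard : ((A.card : ℝ) + B.card) < M := by
    rw [Finset.filter_or, Finset.card_union_of_disjoint hAB] at hc1
    exact_mod_cast hc1
  obtain ⟨l, hlA, hlB⟩ := agl_exists_label q A B hAB
  refine ⟨l, fun f hf hf1 => ?_⟩
  obtain ⟨x, hx⟩ := hc2 f (Finset.mem_filter.2 ⟨Finset.mem_univ _, hf, hf1⟩)
  have hw : (((l (f x)).val : ℤ) - ((l x).val : ℤ)).natAbs ≤ wtZ q (l * f * l⁻¹) := by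
    have := Finset.le_sup (f := fun x : ZMod q =>
      ((((l * f * l⁻¹) x).val : ℤ) - ((x).val : ℤ)).natAbs) (Finset.mem_univ (l x))
    simpa [wtZ] using this
  have hle : q ≤ wtZ q (l * f * l⁻¹) + (A.card + B.card) := by
    rcases hx with ⟨h1, h2⟩ | ⟨h1, h2⟩
    · have := hlA x (Finset.mem_filter.2 ⟨Finset.mem_univ _, h1⟩)
      have := hlB (f x) (Finset.mem_filter.2 ⟨Finset.mem_univ _, h2⟩)
      omega
    · have := hlB x (Finset.mem_filter.2 ⟨Finset.mem_univ _, h1⟩)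
      have := hlA (f x) (Finset.mem_filter.2 ⟨Finset.mem_univ _, h2⟩)
      omega
  have hler : (q : ℝ) ≤ wtZ q (l * f * l⁻¹) + (A.card + B.card) := by exact_mod_cast hle
  linarith
end
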